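/- Let v ≥ k ≥ 2 and n ≥ 1 be integers with n·k - C(n,3) ≤ 2·v < (n+1)·k - C(n+1,3). Then the maximum number of blocks of a directed packing design DPD(v,k) equals n, and it also equals the maximum number of blocks of a PD_2(v,k). -/

import Mathlib

open scoped Classical

/-- A packing design PD_λ(v,k,t): a multiset of k-subsets of `Fin v` such that
every t-subset of points is contained in at most λ blocks. -/
def IsPD (v k t lam : ℕ) (B : Multiset (Finset (Fin v))) : Prop :=
  (∀ b ∈ B, b.card = k) ∧
  ∀ T : Finset (Fin v), T.card = t → B.countP (fun b => T ⊆ b) ≤ lam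

/-- Frequency of a point: the number of blocks (with multiplicity) containing it. -/
def freq {v : ℕ} (B : Multiset (Finset (Fin v))) (x : Fin v) : ℕ :=
  B.countP (fun b => x ∈ b)


/-- The packing number PDN_λ(v,k,t): the maximum number of blocks of a PD_λ(v,k,t). -/
noncomputable def PDN (v k t lam : ℕ) : ℕ :=
  sSup {n | ∃ B : Multiset (Finset (Fin v)), IsPD v k t lam B ∧ Multiset.card B = n}


/-- A directed packing design DPD_λ(v,k,t): a multiset of ordered k-tuples of
distinct points such that every ordered t-tuple of distinct points is a
(not necessarily consecutive) subsequence of at most λ blocks. -/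
def IsDPD (v k t lam : ℕ) (B : Multiset (List (Fin v))) : Prop :=
  (∀ b ∈ B, b.length = k ∧ b.Nodup) ∧
  ∀ L : List (Fin v), L.length = t → L.Nodup → B.countP (fun b => L.Sublist b) ≤ lam

/-- The directed packing number DPDN_λ(v,k,t). -/
noncomputable def DPDN (v k t lam : ℕ) : ℕ :=
  sSup {n | ∃ B : Multiset (List (Fin v)), IsDPD v k t lam B ∧ Multiset.card B = n}

theorem Nat.le_two_add_choose_three (r : ℕ) : r ≤ 2 + r.choose 3 := by
  induction r with
  | zero => omega
  | succ r ih =>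
    rcases Nat.lt_or_ge r 2 with h | h
    · omega
    · have h1 : 0 < r.choose 2 := Nat.choose_pos h
      have h2 : (r + 1).choose 3 = r.choose 2 + r.choose 3 := Nat.choose_succ_succ r 2
      omega

theorem Multiset.countP_map_univ {ι β : Type*} [Fintype ι] (b : ι → β) (p : β → Prop)
    [DecidablePred p] :
    ((Finset.univ : Finset ι).val.map b).countP p
      = (Finset.univ.filter fun i => p (b i)).card := by
  rw [Multiset.countP_map]
  rfl

theorem Multiset.exists_fin_eq_map {β : Type*} (B : Multiset β) :
    ∃ b : Fin (Multiset.card B) → β, B = (Finset.univ : Finset (Fin _)).val.map b := by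
  induction B using Quot.inductionOn with
  | h l =>
    refine ⟨l.get, ?_⟩
    have : (Finset.univ : Finset (Fin l.length)).val.map l.get = (l : Multiset β) := by
      rw [Fin.univ_val_map, List.ofFn_get]
    exact this.symm

/-- Double counting of incidences and of triples of blocks through a common point. -/
theorem card_mul_le_of_pair_le_two {v m k : ℕ} (b : Fin m → Finset (Fin v))
    (hb : ∀ i, (b i).card = k)
    (h2 : ∀ x y, x ≠ y → (Finset.univ.filter fun i => x ∈ b i ∧ y ∈ b i).card ≤ 2) :
    m * k ≤ 2 * v + m.choose 3 := by
  set s : Fin v → Finset (Fin m) := fun x => Finset.univ.filter fun i => x ∈ b i with hs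
  have hsum : ∑ x, (s x).card = m * k := by
    have h := Finset.sum_card_bipartiteAbove_eq_sum_card_bipartiteBelow
      (s := (Finset.univ : Finset (Fin v))) (t := (Finset.univ : Finset (Fin m)))
      (fun x i => x ∈ b i)
    simp only [Finset.bipartiteAbove, Finset.bipartiteBelow] at h
    simpa [hs, hb] using h
  have hdisj : ((Finset.univ : Finset (Fin v)) : Set (Fin v)).PairwiseDisjoint
      (fun x => (s x).powersetCard 3) := by
    intro x _ y _ hxy
    refine Finset.disjoint_left.2 fun T hx hy => ?_
    rw [Finset.mem_powersetCard] at hx hy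
    have hsub : T ⊆ Finset.univ.filter fun i => x ∈ b i ∧ y ∈ b i := by
      intro i hi
      have h₁ := hx.1 hi
      have h₂ := hy.1 hi
      simp only [hs, Finset.mem_filter, Finset.mem_univ, true_and] at h₁ h₂ ⊢
      exact ⟨h₁, h₂⟩
    have := Finset.card_le_card hsub
    have := h2 x y hxy
    omega
  have htri : ∑ x, (s x).card.choose 3 ≤ m.choose 3 := by
    have h := Finset.card_biUnion hdisj
    simp only [Finset.card_powersetCard] at h
    rw [← h]
    calc _ ≤ ((Finset.univ : Finset (Fin m)).powersetCard 3).card := by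
          refine Finset.card_le_card fun T hT => ?_
          obtain ⟨x, _, hx⟩ := Finset.mem_biUnion.1 hT
          exact Finset.mem_powersetCard.2
            ⟨Finset.subset_univ _, (Finset.mem_powersetCard.1 hx).2⟩
      _ = m.choose 3 := by simp
  calc m * k = ∑ x, (s x).card := hsum.symm
    _ ≤ ∑ x, (2 + (s x).card.choose 3) :=
        Finset.sum_le_sum fun x _ => Nat.le_two_add_choose_three _
    _ = 2 * v + ∑ x, (s x).card.choose 3 := by
        rw [Finset.sum_add_distrib]; simp [mul_comm]
    _ ≤ _ := by omega

theorem IsPD.mono {v k t lam : ℕ} {A B : Multiset (Finset (Fin v))} (hB : IsPD v k t lam B)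
    (h : A ≤ B) : IsPD v k t lam A :=
  ⟨fun b hb => hB.1 b (Multiset.mem_of_le h hb),
    fun T hT => (Multiset.countP_le_of_le _ h).trans (hB.2 T hT)⟩

theorem IsPD.card_mul_le {v k : ℕ} {B : Multiset (Finset (Fin v))} (hB : IsPD v k 2 2 B) :
    Multiset.card B * k ≤ 2 * v + (Multiset.card B).choose 3 := by
  obtain ⟨b, hb⟩ := B.exists_fin_eq_map
  refine card_mul_le_of_pair_le_two b (fun i => hB.1 _ ?_) fun x y hxy => ?_
  · rw [hb]
    exact Multiset.mem_map_of_mem b (Finset.mem_univ_val i)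
  · have h := hB.2 {x, y} (Finset.card_pair hxy)
    rw [hb, Multiset.countP_map_univ] at h
    refine le_trans (Finset.card_le_card fun i => ?_) h
    simp [Finset.insert_subset_iff]

theorem IsPD.card_le {v k n : ℕ} {B : Multiset (Finset (Fin v))} (hB : IsPD v k 2 2 B)
    (h : 2 * v + (n + 1).choose 3 < (n + 1) * k) : Multiset.card B ≤ n := by
  by_contra! hn
  obtain ⟨A, hA⟩ := Multiset.card_pos_iff_exists_mem.1
    (by rw [Multiset.card_powersetCard]; exact Nat.choose_pos hn :
      0 < Multiset.card (B.powersetCard (n + 1)))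
  obtain ⟨hA, hc⟩ := Multiset.mem_powersetCard.1 hA
  have := (hB.mono hA).card_mul_le
  rw [hc] at this
  omega

theorem List.pair_sublist_or {α : Type*} {l : List α} {x y : α} (hx : x ∈ l) (hy : y ∈ l)
    (hxy : x ≠ y) : [x, y].Sublist l ∨ [y, x].Sublist l := by
  induction l with
  | nil => simp at hx
  | cons a l ih =>
    rcases List.mem_cons.1 hx with rfl | hx'
    · exact Or.inl
        ((List.singleton_sublist.2 ((List.mem_cons.1 hy).resolve_left hxy.symm)).cons_cons _)
    · rcases List.mem_cons.1 hy with rfl | hy'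
      · exact Or.inr ((List.singleton_sublist.2 hx').cons_cons _)
      · exact (ih hx' hy').imp (·.cons _) (·.cons _)

/-- Forgetting the order of the blocks turns a directed packing into a packing of index two. -/
theorem IsDPD.isPD {v k : ℕ} {B : Multiset (List (Fin v))} (hB : IsDPD v k 2 1 B) :
    IsPD v k 2 2 (B.map List.toFinset) := by
  refine ⟨fun b hb => ?_, fun T hT => ?_⟩
  · obtain ⟨l, hl, rfl⟩ := Multiset.mem_map.1 hb
    rw [List.toFinset_card_of_nodup (hB.1 l hl).2, (hB.1 l hl).1]
  · obtain ⟨x, y, hxy, rfl⟩ := Finset.card_eq_two.1 hT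
    have hx := hB.2 [x, y] rfl (by simpa using hxy)
    have hy := hB.2 [y, x] rfl (by simpa using hxy.symm)
    have hle : (B.map List.toFinset).countP (fun b => {x, y} ⊆ b)
        ≤ B.countP (fun b => [x, y].Sublist b) + B.countP (fun b => [y, x].Sublist b) := by
      rw [Multiset.countP_map, Multiset.countP_eq_card_filter, Multiset.countP_eq_card_filter,
        ← Multiset.card_add, Multiset.filter_add_filter, Multiset.card_add]
      refine le_trans (Multiset.card_le_card ?_) (Nat.le_add_right _ _)
      refine Multiset.monotone_filter_right _ fun l hl => ?_
      rw [Finset.insert_subset_iff, Finset.singleton_subset_iff, List.mem_toFinset,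
        List.mem_toFinset] at hl
      exact List.pair_sublist_or hl.1 hl.2 hxy
    omega

/-- An injective assignment of three natural numbers to every point yields a directed packing:
the `i`-th block consists of the points `x` with `i ∈ T x`, ordered by the product of the
differences `t - i` over the other two members `t` of `T x`. -/
theorem exists_isDPD_of_injective {v k n : ℕ} (T : Fin v → Finset ℕ)
    (hT : Function.Injective T) (h3 : ∀ x, (T x).card = 3)
    (hk : ∀ i < n, (Finset.univ.filter fun x => i ∈ T x).card = k) :
    ∃ B : Multiset (List (Fin v)), IsDPD v k 2 1 B ∧ Multiset.card B = n := by
  set key : ℕ → Fin v → ℤ := fun i x => ∏ t ∈ (T x).erase i, ((t : ℤ) - i) with hkey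
  have key_eq : ∀ x i j, i ∈ T x → j ∈ T x → i ≠ j →
      ∃ l : ℕ, T x = {i, j, l} ∧ key i x = ((j : ℤ) - i) * (l - i) ∧
        key j x = ((i : ℤ) - j) * (l - j) := by
    intro x i j hi hj hij
    have hj' : j ∈ (T x).erase i := Finset.mem_erase.2 ⟨hij.symm, hj⟩
    have hi' : i ∈ (T x).erase j := Finset.mem_erase.2 ⟨hij, hi⟩
    have hc : (((T x).erase i).erase j).card = 1 := by
      rw [Finset.card_erase_of_mem hj', Finset.card_erase_of_mem hi, h3]
    obtain ⟨l, hl⟩ := Finset.card_eq_one.1 hc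
    refine ⟨l, ?_, ?_, ?_⟩
    · rw [← hl, Finset.insert_erase hj', Finset.insert_erase hi]
    · rw [hkey]
      simp only
      rw [← Finset.mul_prod_erase _ _ hj', hl, Finset.prod_singleton]
    · rw [hkey]
      simp only
      rw [← Finset.mul_prod_erase _ _ hi', Finset.erase_right_comm, hl, Finset.prod_singleton]
  set r : ℕ → Fin v → Fin v → Prop := fun i x y => key i x ≤ key i y with hr
  set b : Fin n → List (Fin v) := fun i =>
    (Finset.univ.filter fun x => (i : ℕ) ∈ T x).toList.insertionSort (r i) with hb
  have hperm : ∀ i, (b i).Perm (Finset.univ.filter fun x => (i : ℕ) ∈ T x).toList :=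
    fun i => List.perm_insertionSort _ _
  have hmem : ∀ i x, x ∈ b i → (i : ℕ) ∈ T x := by
    intro i x hx
    simpa using (hperm i).mem_iff.1 hx
  have hsort : ∀ i, (b i).Pairwise (r i) := by
    intro i
    have : Std.Total (r i) := ⟨fun x y => le_total _ _⟩
    have : IsTrans (Fin v) (r i) := ⟨fun x y z => le_trans⟩
    exact List.pairwise_insertionSort _ _
  refine ⟨Finset.univ.val.map b, ⟨?_, ?_⟩, by simp⟩
  · intro l hl
    obtain ⟨i, _, rfl⟩ := Multiset.mem_map.1 hl
    refine ⟨?_, (hperm i).nodup_iff.2 (Finset.nodup_toList _)⟩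
    rw [(hperm i).length_eq, Finset.length_toList, hk i i.2]
  · intro L hL hnd
    obtain ⟨x, y, rfl⟩ := List.length_eq_two.1 hL
    have hxy : x ≠ y := by simpa using hnd
    have hlt : ∀ i j : Fin n, [x, y].Sublist (b i) → [x, y].Sublist (b j) → ¬ i < j := by
      intro i j hi hj hij
      have hij' : (i : ℕ) < j := hij
      have hix := hmem i x (hi.subset (by simp))
      have hiy := hmem i y (hi.subset (by simp))
      have hjx := hmem j x (hj.subset (by simp))
      have hjy := hmem j y (hj.subset (by simp))
      have h₁ : key i x ≤ key i y := (hsort i).forall_sublist hi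
      have h₂ : key j x ≤ key j y := (hsort j).forall_sublist hj
      obtain ⟨l, hl, hl₁, hl₂⟩ := key_eq x i j hix hjx hij'.ne
      obtain ⟨l', hl', hl₁', hl₂'⟩ := key_eq y i j hiy hjy hij'.ne
      rw [hl₁, hl₁'] at h₁
      rw [hl₂, hl₂'] at h₂
      have hpos : (0 : ℤ) < (j : ℕ) - (i : ℕ) := by omega
      have hle : (l : ℤ) ≤ l' := by nlinarith
      have hge : (l' : ℤ) ≤ l := by nlinarith
      have heq : l = l' := by omega
      subst heq
      exact hxy (hT (hl.trans hl'.symm))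
    rw [Multiset.countP_map_univ, Finset.card_le_one]
    intro i hi j hj
    simp only [Finset.mem_filter, Finset.mem_univ, true_and] at hi hj
    exact le_antisymm (not_lt.1 (hlt j i hj hi)) (not_lt.1 (hlt i j hi hj))

/-- If every point lies in at most three blocks, and no two points lie in the same three blocks,
then the blocks can be ordered so as to form a directed packing. -/
theorem exists_isDPD_of_card_le_three {α : Type*} [Fintype α] {v k n : ℕ}
    (hv : Fintype.card α = v) (R : α → Finset ℕ) (hR : ∀ x, R x ⊆ Finset.range n)
    (h3 : ∀ x, (R x).card ≤ 3) (hinj : ∀ x y, (R x).card = 3 → R x = R y → x = y)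
    (hk : ∀ i < n, (Finset.univ.filter fun x => i ∈ R x).card = k) :
    ∃ B : Multiset (List (Fin v)), IsDPD v k 2 1 B ∧ Multiset.card B = n := by
  set e : Fin v ≃ α := (Fintype.equivFinOfCardEq hv).symm with he
  set F : Fin v → Finset ℕ := fun x => Finset.Ico (n + 3 * x) (n + 3 * x + (3 - (R (e x)).card))
    with hF
  have hdisj : ∀ x, Disjoint (R (e x)) (F x) := by
    intro x
    refine Finset.disjoint_left.2 fun i hi hi' => ?_
    have := Finset.mem_range.1 (hR _ hi)
    have := (Finset.mem_Ico.1 hi').1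
    omega
  have hlow : ∀ x i, i < n → (i ∈ R (e x) ∪ F x ↔ i ∈ R (e x)) := by
    intro x i hi
    rw [Finset.mem_union, or_iff_left]
    intro h
    have := (Finset.mem_Ico.1 h).1
    omega
  refine exists_isDPD_of_injective (fun x => R (e x) ∪ F x) ?_ ?_ ?_
  · intro x y hxy
    have hxy' : R (e x) ∪ F x = R (e y) ∪ F y := hxy
    have hReq : R (e x) = R (e y) := by
      ext i
      by_cases hi : i < n
      · rw [← hlow x i hi, ← hlow y i hi, hxy']
      · exact iff_of_false (fun h => hi (Finset.mem_range.1 (hR _ h)))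
          (fun h => hi (Finset.mem_range.1 (hR _ h)))
    by_cases hc : (R (e x)).card = 3
    · exact e.injective (hinj _ _ hc hReq)
    · have hx3 := h3 (e x)
      have hmem : n + 3 * (x : ℕ) ∈ R (e x) ∪ F x :=
        Finset.mem_union_right _ (Finset.mem_Ico.2 ⟨le_rfl, by omega⟩)
      rw [hxy', Finset.mem_union] at hmem
      rcases hmem with h | h
      · have := Finset.mem_range.1 (hR _ h)
        omega
      · have := Finset.mem_Ico.1 h
        exact Fin.ext (by omega)
  · intro x
    rw [Finset.card_union_of_disjoint (hdisj x), Nat.card_Ico]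
    have := h3 (e x)
    omega
  · intro i hi
    rw [← hk i hi]
    refine Finset.card_equiv e fun x => ?_
    simp only [Finset.mem_filter, Finset.mem_univ, true_and]
    exact hlow x i hi

/-- A degree sequence `d` on `range n` with sum at most `2 * m` and entries at most `m` is realised
by `m` sets of at most two elements. -/
theorem exists_card_le_two_of_sum_le {n m : ℕ} (d : ℕ → ℕ)
    (hsum : ∑ i ∈ Finset.range n, d i ≤ 2 * m) (hd : ∀ i < n, d i ≤ m) :
    ∃ R : Fin m → Finset ℕ, (∀ x, R x ⊆ Finset.range n) ∧ (∀ x, (R x).card ≤ 2) ∧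
      ∀ i < n, (Finset.univ.filter fun x => i ∈ R x).card = d i := by
  set P : ℕ → ℕ := fun i => ∑ j ∈ Finset.range i, d j with hP
  have hsucc : ∀ i, P (i + 1) = P i + d i := fun i => Finset.sum_range_succ _ _
  have hmono : Monotone P := monotone_nat_of_le_succ fun i => by rw [hsucc]; omega
  have hle : ∀ i < n, P i + d i ≤ 2 * m := fun i hi => by
    rw [← hsucc]
    exact (hmono hi).trans hsum
  set A : ℕ → Finset ℕ := fun p =>
    (Finset.range n).filter fun i => P i ≤ p ∧ p < P i + d i with hA
  have hA1 : ∀ p, (A p).card ≤ 1 := by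
    intro p
    have hlt : ∀ i ∈ A p, ∀ j ∈ A p, ¬ i < j := by
      intro i hi j hj hij
      have h₁ := (Finset.mem_filter.1 hi).2
      have h₂ := (Finset.mem_filter.1 hj).2
      have h₃ : P (i + 1) ≤ P j := hmono hij
      rw [hsucc] at h₃
      omega
    exact Finset.card_le_one.2 fun i hi j hj =>
      le_antisymm (not_lt.1 (hlt j hj i hi)) (not_lt.1 (hlt i hi j hj))
  refine ⟨fun x => A x ∪ A (x + m), fun x => ?_, fun x => ?_, fun i hi => ?_⟩
  · exact Finset.union_subset (Finset.filter_subset _ _) (Finset.filter_subset _ _)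
  · exact (Finset.card_union_le _ _).trans (Nat.add_le_add (hA1 x) (hA1 (x + m)))
  · have hi₁ := hle i hi
    have hi₂ := hd i hi
    have hc : d i = (Finset.Ico (P i) (P i + d i)).card := by simp
    rw [hc]
    symm
    have hlt : ∀ p ∈ Finset.Ico (P i) (P i + d i), (if p < m then p else p - m) < m := by
      intro p hp
      rw [Finset.mem_Ico] at hp
      split_ifs <;> omega
    refine Finset.card_bij (fun p hp => ⟨if p < m then p else p - m, hlt p hp⟩) ?_ ?_ ?_
    · intro p hp
      rw [Finset.mem_Ico] at hp
      simp only [hA, Finset.mem_filter, Finset.mem_univ, true_and, Finset.mem_union,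
        Finset.mem_range]
      split_ifs <;> omega
    · intro p hp q hq hpq
      rw [Finset.mem_Ico] at hp hq
      simp only [Fin.mk.injEq] at hpq
      split_ifs at hpq <;> omega
    · intro x hx
      simp only [hA, Finset.mem_filter, Finset.mem_univ, true_and, Finset.mem_union,
        Finset.mem_range] at hx
      have hxm := x.2
      rcases hx with h | h
      · exact ⟨x, Finset.mem_Ico.2 h.2, Fin.ext (by simp [hxm])⟩
      · exact ⟨x + m, Finset.mem_Ico.2 h.2, Fin.ext (by simp)⟩

theorem exists_isDPD_card_eq {v k n : ℕ} (hkv : k ≤ v) (hkn : n.choose 2 ≤ k)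
    (h : n * k ≤ 2 * v + n.choose 3) :
    ∃ B : Multiset (List (Fin v)), IsDPD v k 2 1 B ∧ Multiset.card B = n := by
  obtain ⟨U, hU, hUc⟩ := Finset.exists_subset_card_eq
    (s := (Finset.range n).powersetCard 3) (n := n * k - 2 * v)
    (by rw [Finset.card_powersetCard, Finset.card_range]; omega)
  set t := n * k - 2 * v with ht
  have hUs : ∀ T ∈ U, T ⊆ Finset.range n ∧ T.card = 3 := fun T hT =>
    Finset.mem_powersetCard.1 (hU hT)
  set d : ℕ → ℕ := fun i => (U.filter fun T => i ∈ T).card with hd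
  have hdk : ∀ i, d i ≤ k := by
    intro i
    refine le_trans ?_ hkn
    rw [← Finset.card_range n, ← Finset.card_powersetCard]
    refine Finset.card_le_card_of_injOn (fun T => T.erase i) ?_ ?_
    · intro T hT
      obtain ⟨hT, hi⟩ := Finset.mem_filter.1 hT
      refine Finset.mem_coe.2 (Finset.mem_powersetCard.2
        ⟨(Finset.erase_subset _ _).trans (hUs T hT).1, ?_⟩)
      rw [Finset.card_erase_of_mem hi, (hUs T hT).2]
    · intro S hS T hT hST
      have hS' := (Finset.mem_filter.1 hS).2
      have hT' := (Finset.mem_filter.1 hT).2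
      rw [← Finset.insert_erase hS', ← Finset.insert_erase hT']
      exact congrArg (insert i) hST
  have hdsum : ∑ i ∈ Finset.range n, d i = 3 * t := by
    have h := Finset.sum_card_bipartiteAbove_eq_sum_card_bipartiteBelow
      (s := Finset.range n) (t := U) (fun i T => i ∈ T)
    simp only [Finset.bipartiteAbove, Finset.bipartiteBelow] at h
    rw [hd, h, Finset.sum_congr rfl (g := fun _ => 3), Finset.sum_const, hUc, smul_eq_mul,
      mul_comm]
    intro T hT
    rw [Finset.filter_mem_eq_inter, Finset.inter_eq_right.2 (hUs T hT).1, (hUs T hT).2]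
  have hesum : ∑ i ∈ Finset.range n, (k - d i) + 3 * t = n * k := by
    rw [← hdsum, ← Finset.sum_add_distrib, Finset.sum_congr rfl (g := fun _ => k)]
    · simp
    · intro i _
      have := hdk i
      omega
  have ht3 : 0 < t → 3 * t + 2 * k ≤ n * k := by
    intro h0
    have htc : t ≤ n.choose 3 := by omega
    have hn : 3 ≤ n := by
      by_contra! hn
      rw [Nat.choose_eq_zero_of_lt hn] at htc
      omega
    have hc : n.choose 3 * 3 = n.choose 2 * (n - 2) := Nat.choose_succ_right_eq n 2
    obtain ⟨c, rfl⟩ : ∃ c, n = c + 2 := ⟨n - 2, by omega⟩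
    rw [Nat.add_sub_cancel] at hc
    have := Nat.mul_le_mul_right c hkn
    nlinarith
  have htv : t ≤ v := by omega
  obtain ⟨R, hRn, hR2, hRd⟩ := exists_card_le_two_of_sum_le (n := n) (m := v - t)
    (fun i => k - d i) (by omega) (fun i _ => by
      rcases Nat.eq_zero_or_pos t with h0 | h0
      · omega
      · have := ht3 h0
        omega)
  refine exists_isDPD_of_card_le_three (α := U ⊕ Fin (v - t)) ?_
    (Sum.elim (fun T => T.1) R) ?_ ?_ ?_ ?_
  · simp [hUc]
    omega
  · rintro (T | x)
    · exact (hUs _ T.2).1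
    · exact hRn x
  · rintro (T | x)
    · exact (hUs _ T.2).2.le
    · exact (hR2 x).trans (by norm_num)
  · rintro (T | x) (S | y) hc hST
    · exact congrArg Sum.inl (Subtype.ext hST)
    · have := hR2 y
      simp only [Sum.elim_inl, Sum.elim_inr] at hc hST
      rw [hST] at hc
      omega
    all_goals
      have := hR2 x
      simp only [Sum.elim_inr] at hc
      omega
  · intro i hi
    have hsplit : k = d i + (Finset.univ.filter fun x => i ∈ R x).card := by
      have := hdk i
      rw [hRd i hi]
      omega
    rw [hsplit]
    simp only [hd, Finset.card_filter]
    rw [Fintype.sum_sum_type, ← Finset.sum_coe_sort U]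
    rfl

theorem stmt15 (v k n : ℕ) (hk : 2 ≤ k) (hkv : k ≤ v) (hn : 1 ≤ n)
    (h1 : (n * k : ℤ) - n.choose 3 ≤ 2 * v)
    (h2 : (2 * v : ℤ) < (n + 1) * k - (n + 1).choose 3) :
    DPDN v k 2 1 = n ∧ PDN v k 2 2 = n := by
  have hs : (n + 1).choose 3 = n.choose 2 + n.choose 3 := Nat.choose_succ_succ n 2
  have h1' : n * k ≤ 2 * v + n.choose 3 := by zify; linarith
  have h2' : 2 * v + (n + 1).choose 3 < (n + 1) * k := by zify; linarith
  have hkn : n.choose 2 ≤ k := by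
    rw [hs, Nat.add_one_mul n k] at h2'
    omega
  obtain ⟨B, hB, hBn⟩ := exists_isDPD_card_eq hkv hkn h1'
  constructor
  · refine IsGreatest.csSup_eq ⟨⟨B, hB, hBn⟩, ?_⟩
    rintro _ ⟨A, hA, rfl⟩
    simpa using hA.isPD.card_le h2'
  · refine IsGreatest.csSup_eq ⟨⟨_, hB.isPD, by simpa using hBn⟩, ?_⟩
    rintro _ ⟨A, hA, rfl⟩
    exact hA.card_le h2'
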